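/- For the elephant random walk remembering only the most recent step: if X_1 = 1 almost surely (or X_1 = −1 almost surely), then T_n/√n converges in distribution to a centered normal law with variance p/(1−p) as n → ∞; consequently, for an arbitrary {−1,+1}-valued initial step X_1, the partial sums S_n satisfy S_n/√n → N(0, p/(1−p)) in distribution as n → ∞. -/

import Mathlib

open MeasureTheory ProbabilityTheory Filter Topology

noncomputable section

/-- The σ-algebra generated by the steps `X 1, …, X n`. -/
def sigmaUpTo {Ω : Type*} (X : ℕ → Ω → ℝ) (n : ℕ) : MeasurableSpace Ω :=
  ⨆ i ∈ Finset.Icc 1 n, MeasurableSpace.comap (X i) inferInstance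

/-- The σ-algebra generated by all the steps `X 1, X 2, …`. -/
def sigmaAll {Ω : Type*} (X : ℕ → Ω → ℝ) : MeasurableSpace Ω :=
  ⨆ i ∈ Set.Ici 1, MeasurableSpace.comap (X i) inferInstance

/-- The partial sum `X 1 + ⋯ + X n` of the walk. -/
def partialSum {Ω : Type*} (X : ℕ → Ω → ℝ) (n : ℕ) (ω : Ω) : ℝ :=
  ∑ k ∈ Finset.Icc 1 n, X k ω

/-- Convergence in distribution of the random variables `f n` to the law `ν`,
expressed as weak convergence tested against bounded continuous functions. -/
def TendstoInDistribution {Ω : Type*} [MeasurableSpace Ω] (μ : Measure Ω)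
    (f : ℕ → Ω → ℝ) (ν : Measure ℝ) : Prop :=
  ∀ g : BoundedContinuousFunction ℝ ℝ,
    Tendsto (fun n => ∫ ω, g (f n ω) ∂μ) atTop (𝓝 (∫ x, g x ∂ν))

theorem measurable_partialSum_sigmaUpTo {Ω : Type*} (X : ℕ → Ω → ℝ) (n : ℕ) :
    Measurable[sigmaUpTo X n] (partialSum X n) := by
  refine Finset.measurable_fun_sum _ fun i hi => ?_
  exact (comap_measurable (X i)).mono
    (le_iSup₂ (f := fun i (_ : i ∈ Finset.Icc 1 n) => MeasurableSpace.comap (X i) inferInstance)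
      i hi) le_rfl

theorem sigmaUpTo_le {Ω : Type*} [mΩ : MeasurableSpace Ω] {X : ℕ → Ω → ℝ}
    (hX : ∀ i, Measurable (X i)) (n : ℕ) : sigmaUpTo X n ≤ mΩ :=
  iSup₂_le fun i _ => (hX i).comap_le

theorem partialSum_succ {Ω : Type*} (X : ℕ → Ω → ℝ) (n : ℕ) (ω : Ω) :
    partialSum X (n + 1) ω = partialSum X n ω + X (n + 1) ω :=
  Finset.sum_Icc_succ_top (by omega) _

/-- The pull-out property, integrated, for a real factor with known conditional expectation and a
bounded complex factor. -/
theorem integral_ofReal_mul_eq_of_condExp {Ω : Type*} {m mΩ : MeasurableSpace Ω} {μ : Measure Ω}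
    [IsFiniteMeasure μ] (hm : m ≤ mΩ) {f : Ω → ℂ} (hf : StronglyMeasurable[m] f)
    {c : ℝ} (hfc : ∀ ω, ‖f ω‖ ≤ c) {g h : Ω → ℝ} (hg : Integrable g μ)
    (hgh : μ[g | m] =ᵐ[μ] h) :
    ∫ ω, (g ω : ℂ) * f ω ∂μ = ∫ ω, (h ω : ℂ) * f ω ∂μ := by
  have hint : Integrable (fun ω => (g ω : ℂ) * f ω) μ :=
    hg.ofReal.mul_bdd (hf.mono hm).aestronglyMeasurable (ae_of_all _ hfc)
  have key := condExp_bilin_of_stronglyMeasurable_left (μ := μ)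
    (ContinuousLinearMap.lsmul ℝ ℝ (E := ℂ)).flip hf (g := g) (by simpa using hint) hg
  simp only [ContinuousLinearMap.flip_apply, ContinuousLinearMap.lsmul_apply,
    Complex.real_smul] at key
  rw [← integral_condExp hm (f := fun ω => (g ω : ℂ) * f ω)]
  refine integral_congr_ae ?_
  filter_upwards [key, hgh] with ω h1 h2
  rw [h1, h2]

/-- One step of the transfer matrix, tested against an approximate left eigenvector. -/
theorem norm_transfer_step_sub_le {r m θ : ℝ} (hr : |r| ≤ 1) (hrm : r * (1 + m) = m)
    (hθ : |θ| ≤ 1) {a b : ℂ} (ha : ‖a‖ ≤ 1) (hb : ‖b‖ ≤ 1) :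
    ‖(Real.cos θ * a + Complex.I * Real.sin θ * (r * b)
        + Complex.I * (m * θ) * (Real.cos θ * (r * b) + Complex.I * Real.sin θ * a))
      - ((1 - (1 + 2 * m) * θ ^ 2 / 2 : ℝ) : ℂ) * (a + Complex.I * (m * θ) * b)‖
      ≤ (2 + 2 * |m| + |m| * |1 + 2 * m|) * |θ| ^ 3 := by
  have h0 := abs_nonneg θ
  have hM := abs_nonneg m
  have hcos : |Real.cos θ - (1 - θ ^ 2 / 2)| ≤ |θ| ^ 3 := by
    refine (Real.cos_bound hθ).trans ?_
    nlinarith [pow_nonneg h0 3]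
  have hcos' : |Real.cos θ - 1| ≤ |θ| ^ 2 := by
    rw [sq_abs, abs_le]
    constructor <;> nlinarith [Real.one_sub_sq_div_two_le_cos (x := θ), Real.cos_le_one θ]
  have hsin : |Real.sin θ - θ| ≤ |θ| ^ 3 := by
    have h := Real.sin_bound hθ
    have h5 : |θ| ^ 5 ≤ |θ| ^ 3 := pow_le_pow_of_le_one h0 hθ (by norm_num)
    calc |Real.sin θ - θ| = |(Real.sin θ - (θ - θ ^ 3 / 6)) + -(θ ^ 3 / 6)| := by ring_nf
      _ ≤ |Real.sin θ - (θ - θ ^ 3 / 6)| + |-(θ ^ 3 / 6)| := abs_add_le _ _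
      _ ≤ |θ| ^ 5 / 100 + |θ| ^ 3 / 6 := by
        gcongr
        rw [abs_neg, abs_div, abs_pow]; norm_num
      _ ≤ |θ| ^ 3 := by nlinarith [pow_nonneg h0 3]
  have hA : |(Real.cos θ - (1 - θ ^ 2 / 2)) - m * (θ * (Real.sin θ - θ))|
      ≤ (1 + |m|) * |θ| ^ 3 := by
    refine (abs_sub _ _).trans ?_
    rw [abs_mul, abs_mul]
    have : |θ| * |Real.sin θ - θ| ≤ 1 * |θ| ^ 3 := by gcongr
    nlinarith [mul_le_mul_of_nonneg_left this hM]
  have hB : |r * (Real.sin θ - θ) + r * (m * (θ * (Real.cos θ - 1)))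
      + m * (1 + 2 * m) * (θ ^ 3 / 2)| ≤ (1 + |m| + |m| * |1 + 2 * m|) * |θ| ^ 3 := by
    refine (abs_add_three _ _ _).trans ?_
    simp only [abs_mul, abs_div, abs_pow, abs_two]
    have h1 : |r| * |Real.sin θ - θ| ≤ 1 * |θ| ^ 3 := by gcongr
    have h2 : |r| * (|m| * (|θ| * |Real.cos θ - 1|)) ≤ 1 * (|m| * (|θ| * |θ| ^ 2)) := by gcongr
    have h3 : |m| * |1 + 2 * m| * (|θ| ^ 3 / 2) ≤ |m| * |1 + 2 * m| * |θ| ^ 3 := by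
      gcongr; linarith [pow_nonneg h0 3]
    nlinarith
  have hrmC : (r : ℂ) * (1 + m) = m := by exact_mod_cast hrm
  have hsplit : (Real.cos θ * a + Complex.I * Real.sin θ * (r * b)
        + Complex.I * (m * θ) * (Real.cos θ * (r * b) + Complex.I * Real.sin θ * a))
      - ((1 - (1 + 2 * m) * θ ^ 2 / 2 : ℝ) : ℂ) * (a + Complex.I * (m * θ) * b)
      = (((Real.cos θ - (1 - θ ^ 2 / 2)) - m * (θ * (Real.sin θ - θ)) : ℝ) : ℂ) * a
        + Complex.I * ((r * (Real.sin θ - θ) + r * (m * (θ * (Real.cos θ - 1)))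
          + m * (1 + 2 * m) * (θ ^ 3 / 2) : ℝ) : ℂ) * b := by
    push_cast
    linear_combination (m * θ * a * Complex.sin θ) * Complex.I_sq
      + (Complex.I * θ * b) * hrmC
  rw [hsplit]
  refine (norm_add_le _ _).trans ?_
  simp only [norm_mul, Complex.norm_I, Complex.norm_real, Real.norm_eq_abs, one_mul]
  calc _ ≤ (1 + |m|) * |θ| ^ 3 * 1 + (1 + |m| + |m| * |1 + 2 * m|) * |θ| ^ 3 * 1 := by
        gcongr
    _ = _ := by ring

/-- Bounded solutions of the transfer recursion stay close to the powers of the approximate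
eigenvalue. -/
theorem norm_transfer_sub_pow_le {r m θ : ℝ} (hr : |r| ≤ 1) (hrm : r * (1 + m) = m)
    (hθ : |θ| ≤ 1) (hρ : |1 - (1 + 2 * m) * θ ^ 2 / 2| ≤ 1) {a b : ℕ → ℂ}
    (ha : ∀ n, 1 ≤ n → ‖a n‖ ≤ 1) (hb : ∀ n, 1 ≤ n → ‖b n‖ ≤ 1) (ha1 : ‖a 1 - 1‖ ≤ |θ|)
    (hastep : ∀ n, 1 ≤ n →
      a (n + 1) = Real.cos θ * a n + Complex.I * Real.sin θ * (r * b n))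
    (hbstep : ∀ n, 1 ≤ n →
      b (n + 1) = Real.cos θ * (r * b n) + Complex.I * Real.sin θ * a n)
    {n : ℕ} (hn : 1 ≤ n) :
    ‖a n - ((1 - (1 + 2 * m) * θ ^ 2 / 2 : ℝ) : ℂ) ^ n‖
      ≤ (1 + 2 * |m| + |1 + 2 * m|) * |θ|
        + (2 + 2 * |m| + |m| * |1 + 2 * m|) * (n * |θ| ^ 3) := by
  set ρ : ℝ := 1 - (1 + 2 * m) * θ ^ 2 / 2 with hρdef
  have hcorr : ∀ k, 1 ≤ k → ‖Complex.I * (m * θ) * b k‖ ≤ |m| * |θ| := fun k hk => by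
    simp only [norm_mul, Complex.norm_I, Complex.norm_real, Real.norm_eq_abs, one_mul]
    exact mul_le_of_le_one_right (by positivity) (hb k hk)
  have hρ1 : ‖(1 : ℂ) - ρ‖ ≤ |1 + 2 * m| * |θ| := by
    have : (1 : ℂ) - ρ = (((1 + 2 * m) * (θ ^ 2 / 2) : ℝ) : ℂ) := by
      rw [hρdef]; push_cast; ring
    rw [this, Complex.norm_real, Real.norm_eq_abs, abs_mul,
      abs_of_nonneg (by positivity : 0 ≤ θ ^ 2 / 2)]
    gcongr
    nlinarith [sq_abs θ, abs_nonneg θ]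
  have hmain : ‖(a n + Complex.I * (m * θ) * b n) - (ρ : ℂ) ^ n‖
      ≤ (1 + |m| + |1 + 2 * m|) * |θ|
        + (2 + 2 * |m| + |m| * |1 + 2 * m|) * (n * |θ| ^ 3) := by
    induction n, hn using Nat.le_induction with
    | base =>
      have : (a 1 + Complex.I * (m * θ) * b 1) - (ρ : ℂ) ^ 1
          = (a 1 - 1) + Complex.I * (m * θ) * b 1 + (1 - ρ) := by ring
      rw [this]
      refine (norm_add₃_le).trans ?_
      have : 0 ≤ (2 + 2 * |m| + |m| * |1 + 2 * m|) * (((1 : ℕ) : ℝ) * |θ| ^ 3) := by positivity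
      linarith [hcorr 1 le_rfl]
    | succ k hk ih =>
      have hstep := norm_transfer_step_sub_le hr hrm hθ (ha k hk) (hb k hk)
      rw [← hastep k hk, ← hbstep k hk, ← hρdef] at hstep
      have hsplit : (a (k + 1) + Complex.I * (m * θ) * b (k + 1)) - (ρ : ℂ) ^ (k + 1)
          = ((a (k + 1) + Complex.I * (m * θ) * b (k + 1))
              - ρ * (a k + Complex.I * (m * θ) * b k))
            + ρ * ((a k + Complex.I * (m * θ) * b k) - (ρ : ℂ) ^ k) := by ring
      rw [hsplit]
      refine (norm_add_le _ _).trans ?_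
      have hcontr : ‖(ρ : ℂ) * ((a k + Complex.I * (m * θ) * b k) - (ρ : ℂ) ^ k)‖
          ≤ ‖(a k + Complex.I * (m * θ) * b k) - (ρ : ℂ) ^ k‖ := by
        rw [norm_mul, Complex.norm_real, Real.norm_eq_abs]
        exact mul_le_of_le_one_left (norm_nonneg _) hρ
      push_cast
      linarith
  have : a n - (ρ : ℂ) ^ n
      = ((a n + Complex.I * (m * θ) * b n) - (ρ : ℂ) ^ n) - Complex.I * (m * θ) * b n := by ring
  rw [this]
  refine (norm_sub_le _ _).trans ?_
  linarith [hcorr n hn]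

theorem exp_mul_add_sign_mul_I (θ s : ℝ) {x : ℝ} (hx : x = 1 ∨ x = -1) :
    Complex.exp (θ * ((s + x : ℝ) : ℂ) * Complex.I)
      = Real.cos θ * Complex.exp (θ * s * Complex.I)
        + Complex.I * Real.sin θ * (x * Complex.exp (θ * s * Complex.I)) := by
  have : (θ : ℂ) * ((s + x : ℝ) : ℂ) * Complex.I
      = θ * s * Complex.I + ((θ * x : ℝ) : ℂ) * Complex.I := by
    push_cast; ring
  rw [this, Complex.exp_add, Complex.exp_mul_I ((θ * x : ℝ) : ℂ)]
  rcases hx with rfl | rfl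
  all_goals push_cast; simp; ring

theorem norm_exp_partialSum {Ω : Type*} {X : ℕ → Ω → ℝ} (θ : ℝ) (n : ℕ) (ω : Ω) :
    ‖Complex.exp (θ * partialSum X n ω * Complex.I)‖ = 1 := by
  rw [← Complex.ofReal_mul, Complex.norm_exp_ofReal_mul_I]

theorem stronglyMeasurable_exp_partialSum {Ω : Type*} (X : ℕ → Ω → ℝ) (θ : ℝ) (n : ℕ) :
    StronglyMeasurable[sigmaUpTo X n]
      (fun ω => Complex.exp (θ * partialSum X n ω * Complex.I)) := by
  have h := measurable_partialSum_sigmaUpTo X n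
  have hc : Measurable fun x : ℝ => Complex.exp (θ * x * Complex.I) := by fun_prop
  exact (hc.comp h).stronglyMeasurable

section Walk

variable {Ω : Type*} [MeasurableSpace Ω] {μ : Measure Ω} [IsProbabilityMeasure μ]
  {X : ℕ → Ω → ℝ}

theorem integrable_of_sign (hX : ∀ i, Measurable (X i))
    (hval : ∀ i, 1 ≤ i → ∀ᵐ ω ∂μ, X i ω = 1 ∨ X i ω = -1) {n : ℕ} (hn : 1 ≤ n) :
    Integrable (X n) μ := by
  refine Integrable.of_bound (hX n).aestronglyMeasurable 1 ?_
  filter_upwards [hval n hn] with ω h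
  rcases h with h | h <;> simp [h]

theorem integrable_exp_partialSum (hX : ∀ i, Measurable (X i)) (θ : ℝ) (n : ℕ) :
    Integrable (fun ω => Complex.exp (θ * partialSum X n ω * Complex.I)) μ :=
  .of_bound ((stronglyMeasurable_exp_partialSum X θ n).mono
    (sigmaUpTo_le hX n)).aestronglyMeasurable 1 (ae_of_all _ fun ω => (norm_exp_partialSum θ n ω).le)

theorem integrable_sign_mul_exp_partialSum (hX : ∀ i, Measurable (X i))
    (hval : ∀ i, 1 ≤ i → ∀ᵐ ω ∂μ, X i ω = 1 ∨ X i ω = -1) (θ : ℝ) {k : ℕ} (hk : 1 ≤ k) (n : ℕ) :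
    Integrable (fun ω => (X k ω : ℂ) * Complex.exp (θ * partialSum X n ω * Complex.I)) μ :=
  (integrable_of_sign hX hval hk).ofReal.mul_bdd
    (integrable_exp_partialSum hX θ n).aestronglyMeasurable
    (ae_of_all _ fun ω => (norm_exp_partialSum θ n ω).le)

variable {r : ℝ}

theorem integral_next_sign_mul_exp (hX : ∀ i, Measurable (X i))
    (hval : ∀ i, 1 ≤ i → ∀ᵐ ω ∂μ, X i ω = 1 ∨ X i ω = -1)
    (hcond : ∀ n, 1 ≤ n → μ[X (n + 1) | sigmaUpTo X n] =ᵐ[μ] fun ω => r * X n ω)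
    (θ : ℝ) {n : ℕ} (hn : 1 ≤ n) :
    ∫ ω, (X (n + 1) ω : ℂ) * Complex.exp (θ * partialSum X n ω * Complex.I) ∂μ
      = r * ∫ ω, (X n ω : ℂ) * Complex.exp (θ * partialSum X n ω * Complex.I) ∂μ := by
  rw [integral_ofReal_mul_eq_of_condExp (sigmaUpTo_le hX n)
    (stronglyMeasurable_exp_partialSum X θ n) (fun ω => (norm_exp_partialSum θ n ω).le)
    (integrable_of_sign hX hval (by omega)) (hcond n hn), ← integral_const_mul]
  refine integral_congr_ae (ae_of_all _ fun ω => ?_)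
  push_cast
  ring

theorem integral_exp_partialSum_succ (hX : ∀ i, Measurable (X i))
    (hval : ∀ i, 1 ≤ i → ∀ᵐ ω ∂μ, X i ω = 1 ∨ X i ω = -1)
    (hcond : ∀ n, 1 ≤ n → μ[X (n + 1) | sigmaUpTo X n] =ᵐ[μ] fun ω => r * X n ω)
    (θ : ℝ) {n : ℕ} (hn : 1 ≤ n) :
    ∫ ω, Complex.exp (θ * partialSum X (n + 1) ω * Complex.I) ∂μ
      = Real.cos θ * ∫ ω, Complex.exp (θ * partialSum X n ω * Complex.I) ∂μ
        + Complex.I * Real.sin θ *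
          (r * ∫ ω, (X n ω : ℂ) * Complex.exp (θ * partialSum X n ω * Complex.I) ∂μ) := by
  rw [← integral_next_sign_mul_exp hX hval hcond θ hn, ← integral_const_mul, ← integral_const_mul,
    ← integral_add ((integrable_exp_partialSum hX θ n).const_mul _)
      ((integrable_sign_mul_exp_partialSum hX hval θ (by omega) n).const_mul _)]
  refine integral_congr_ae ?_
  filter_upwards [hval (n + 1) (by omega)] with ω h
  rw [partialSum_succ, exp_mul_add_sign_mul_I θ _ h]

theorem integral_sign_mul_exp_partialSum_succ (hX : ∀ i, Measurable (X i))
    (hval : ∀ i, 1 ≤ i → ∀ᵐ ω ∂μ, X i ω = 1 ∨ X i ω = -1)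
    (hcond : ∀ n, 1 ≤ n → μ[X (n + 1) | sigmaUpTo X n] =ᵐ[μ] fun ω => r * X n ω)
    (θ : ℝ) {n : ℕ} (hn : 1 ≤ n) :
    ∫ ω, (X (n + 1) ω : ℂ) * Complex.exp (θ * partialSum X (n + 1) ω * Complex.I) ∂μ
      = Real.cos θ *
          (r * ∫ ω, (X n ω : ℂ) * Complex.exp (θ * partialSum X n ω * Complex.I) ∂μ)
        + Complex.I * Real.sin θ *
          ∫ ω, Complex.exp (θ * partialSum X n ω * Complex.I) ∂μ := by
  rw [← integral_next_sign_mul_exp hX hval hcond θ hn, ← integral_const_mul, ← integral_const_mul,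
    ← integral_add ((integrable_sign_mul_exp_partialSum hX hval θ (by omega) n).const_mul _)
      ((integrable_exp_partialSum hX θ n).const_mul _)]
  refine integral_congr_ae ?_
  filter_upwards [hval (n + 1) (by omega)] with ω h
  have hsq : (X (n + 1) ω : ℂ) * X (n + 1) ω = 1 := by
    rcases h with h | h <;> simp [h]
  rw [partialSum_succ, exp_mul_add_sign_mul_I θ _ h]
  linear_combination (Complex.I * Real.sin θ
    * Complex.exp (θ * partialSum X n ω * Complex.I)) * hsq

theorem norm_integral_exp_partialSum_one_sub_le (hX : ∀ i, Measurable (X i))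
    (hval : ∀ i, 1 ≤ i → ∀ᵐ ω ∂μ, X i ω = 1 ∨ X i ω = -1) (θ : ℝ) :
    ‖∫ ω, Complex.exp (θ * partialSum X 1 ω * Complex.I) ∂μ - 1‖ ≤ |θ| := by
  have : ∫ ω, Complex.exp (θ * partialSum X 1 ω * Complex.I) ∂μ - 1
      = ∫ ω, (Complex.exp (θ * partialSum X 1 ω * Complex.I) - 1) ∂μ := by
    rw [integral_sub (integrable_exp_partialSum hX θ 1) (integrable_const _)]
    simp
  rw [this]
  refine (norm_integral_le_of_norm_le_const (C := |θ|) ?_).trans (by simp)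
  filter_upwards [hval 1 le_rfl] with ω h
  have hb := Real.norm_exp_I_mul_ofReal_sub_one_le (x := θ * X 1 ω)
  have habs : |X 1 ω| = 1 := by rcases h with h | h <;> simp [h]
  rw [Real.norm_eq_abs, abs_mul, habs, mul_one] at hb
  convert! hb using 4
  simp [partialSum, mul_comm]

theorem tendsto_integral_exp_partialSum (hX : ∀ i, Measurable (X i))
    (hval : ∀ i, 1 ≤ i → ∀ᵐ ω ∂μ, X i ω = 1 ∨ X i ω = -1)
    (hcond : ∀ n, 1 ≤ n → μ[X (n + 1) | sigmaUpTo X n] =ᵐ[μ] fun ω => r * X n ω)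
    {m : ℝ} (hr : |r| ≤ 1) (hrm : r * (1 + m) = m) (hm : 0 ≤ 1 + 2 * m) (t : ℝ) :
    Tendsto (fun n : ℕ =>
        ∫ ω, Complex.exp ((t / √n : ℝ) * partialSum X n ω * Complex.I) ∂μ) atTop
      (𝓝 (Complex.exp (-((1 + 2 * m) * t ^ 2 / 2 : ℝ)))) := by
  have hsqrt : Tendsto (fun n : ℕ => √(n : ℝ)) atTop atTop :=
    Real.tendsto_sqrt_atTop.comp tendsto_natCast_atTop_atTop
  have hθ : Tendsto (fun n : ℕ => t / √n) atTop (𝓝 0) := hsqrt.const_div_atTop t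
  have hθsq : ∀ n : ℕ, (t / √n) ^ 2 = t ^ 2 / n := fun n => by
    rw [div_pow, Real.sq_sqrt n.cast_nonneg]
  have hpow : Tendsto (fun n : ℕ => ((1 - (1 + 2 * m) * (t / √n) ^ 2 / 2 : ℝ) : ℂ) ^ n) atTop
      (𝓝 (Complex.exp (-((1 + 2 * m) * t ^ 2 / 2 : ℝ)))) := by
    refine (Complex.tendsto_one_add_div_pow_exp _).congr fun n => ?_
    rw [hθsq]
    push_cast
    ring
  have hcube : ∀ᶠ n : ℕ in atTop, (n : ℝ) * |t / √n| ^ 3 = t ^ 2 * |t / √n| := by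
    filter_upwards [eventually_ne_atTop 0] with n hn
    have : (n : ℝ) ≠ 0 := by exact_mod_cast hn
    rw [pow_succ, sq_abs, hθsq]
    field_simp
  have hbound : Tendsto (fun n : ℕ => (1 + 2 * |m| + |1 + 2 * m|) * |t / √n|
      + (2 + 2 * |m| + |m| * |1 + 2 * m|) * ((n : ℝ) * |t / √n| ^ 3)) atTop (𝓝 0) := by
    have h0 : Tendsto (fun n : ℕ => |t / √n|) atTop (𝓝 0) := by simpa using hθ.abs
    have h1 : Tendsto (fun n : ℕ => (n : ℝ) * |t / √n| ^ 3) atTop (𝓝 0) :=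
      (tendsto_congr' hcube).2 (by simpa using h0.const_mul (t ^ 2))
    simpa using (h0.const_mul _).add (h1.const_mul _)
  have hdiff : Tendsto (fun n : ℕ =>
      ∫ ω, Complex.exp ((t / √n : ℝ) * partialSum X n ω * Complex.I) ∂μ
        - ((1 - (1 + 2 * m) * (t / √n) ^ 2 / 2 : ℝ) : ℂ) ^ n) atTop (𝓝 0) := by
    refine squeeze_zero_norm' ?_ hbound
    have hsmall : Tendsto (fun n : ℕ => (1 + 2 * m) * (t / √n) ^ 2 / 2) atTop (𝓝 0) := by
      simpa using ((hθ.pow 2).const_mul (1 + 2 * m)).div_const 2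
    have habs : Tendsto (fun n : ℕ => |t / √n|) atTop (𝓝 0) := by simpa using hθ.abs
    filter_upwards [eventually_ge_atTop 1, hsmall.eventually_le_const one_pos,
      habs.eventually_le_const one_pos] with n hn hs hle
    have hnonneg : 0 ≤ (1 + 2 * m) * (t / √n) ^ 2 / 2 := by positivity
    refine norm_transfer_sub_pow_le hr hrm hle (abs_le.2 ⟨by linarith, by linarith⟩)
      (a := fun k => ∫ ω, Complex.exp ((t / √n : ℝ) * partialSum X k ω * Complex.I) ∂μ)
      (b := fun k => ∫ ω, (X k ω : ℂ) *
        Complex.exp ((t / √n : ℝ) * partialSum X k ω * Complex.I) ∂μ)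
      (fun k _ => ?_) (fun k hk => ?_)
      (norm_integral_exp_partialSum_one_sub_le hX hval _)
      (fun k hk => integral_exp_partialSum_succ hX hval hcond _ hk)
      (fun k hk => integral_sign_mul_exp_partialSum_succ hX hval hcond _ hk) hn
    · refine (norm_integral_le_of_norm_le_const (C := 1)
        (ae_of_all _ fun ω => (norm_exp_partialSum _ k ω).le)).trans (by simp)
    · refine (norm_integral_le_of_norm_le_const (C := 1) ?_).trans (by simp)
      filter_upwards [hval k hk] with ω h
      rw [norm_mul, norm_exp_partialSum]
      rcases h with h | h <;> simp [h]
  simpa using hdiff.add hpow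

end Walk

/-- Lévy's continuity theorem for the test-function form of convergence in distribution. -/
theorem tendstoInDistribution_of_tendsto_charFun {Ω : Type*} [MeasurableSpace Ω] {μ : Measure Ω}
    [IsProbabilityMeasure μ] {f : ℕ → Ω → ℝ} (hf : ∀ n, Measurable (f n)) {ν : Measure ℝ}
    [IsProbabilityMeasure ν]
    (h : ∀ t : ℝ, Tendsto (fun n => charFun (μ.map (f n)) t) atTop (𝓝 (charFun ν t))) :
    _root_.TendstoInDistribution μ f ν := by
  intro g
  have hprob : ∀ n, IsProbabilityMeasure (μ.map (f n)) := fun n =>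
    Measure.isProbabilityMeasure_map (hf n).aemeasurable
  let laws : ℕ → ProbabilityMeasure ℝ := fun n => ⟨μ.map (f n), hprob n⟩
  let law : ProbabilityMeasure ℝ := ⟨ν, inferInstance⟩
  have hweak : Tendsto laws atTop (𝓝 law) := ProbabilityMeasure.tendsto_iff_tendsto_charFun.2 h
  refine (ProbabilityMeasure.tendsto_iff_forall_integral_tendsto.1 hweak g).congr fun n => ?_
  exact integral_map (hf n).aemeasurable g.continuous.aestronglyMeasurable

/-- for the elephant random walk remembering only the most recent step:
if `X₁ = 1` a.s. or `X₁ = -1` a.s. then `Tₙ/√n → N(0, p/(1-p))` in distribution;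
consequently, for an arbitrary `{-1,+1}`-valued first step, `Sₙ/√n → N(0, p/(1-p))` in
distribution. -/
theorem elephant_last_step_clt
    {Ω : Type*} [MeasurableSpace Ω] (μ : Measure Ω) [IsProbabilityMeasure μ]
    (p : ℝ) (hp0 : 0 < p) (hp1 : p < 1)
    (X : ℕ → Ω → ℝ)
    (hXmeas : ∀ i, Measurable (X i))
    (hval : ∀ i, 1 ≤ i → ∀ᵐ ω ∂μ, X i ω = 1 ∨ X i ω = -1)
    (hcond : ∀ n, 1 ≤ n →
      μ[X (n+1) | sigmaUpTo X n] =ᵐ[μ] fun ω => (2*p-1) * X n ω) :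
    (((∀ᵐ ω ∂μ, X 1 ω = 1) ∨ (∀ᵐ ω ∂μ, X 1 ω = -1)) →
      TendstoInDistribution μ (fun n ω => partialSum X n ω / Real.sqrt n)
        (gaussianReal 0 (Real.toNNReal (p/(1-p))))) ∧
    TendstoInDistribution μ (fun n ω => partialSum X n ω / Real.sqrt n)
      (gaussianReal 0 (Real.toNNReal (p/(1-p)))) := by
  suffices h : _root_.TendstoInDistribution μ (fun n ω => partialSum X n ω / Real.sqrt n)
      (gaussianReal 0 (Real.toNNReal (p / (1 - p)))) from ⟨fun _ => h, h⟩
  have hmeas : ∀ n, Measurable (partialSum X n) := fun n =>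
    Finset.measurable_fun_sum _ fun i _ => hXmeas i
  refine tendstoInDistribution_of_tendsto_charFun (fun n => (hmeas n).div_const _) fun t => ?_
  have hq : 1 - p ≠ 0 := by linarith
  have hvar : 1 + 2 * ((2 * p - 1) / (2 * (1 - p))) = p / (1 - p) := by
    field_simp
    ring
  have hvar0 : 0 ≤ p / (1 - p) := div_nonneg hp0.le (by linarith)
  have hlim := tendsto_integral_exp_partialSum hXmeas hval hcond
    (m := (2 * p - 1) / (2 * (1 - p))) (abs_le.2 ⟨by linarith, by linarith⟩)
    (by field_simp; ring) (hvar ▸ hvar0) t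
  rw [hvar] at hlim
  have hgauss : charFun (gaussianReal 0 (Real.toNNReal (p / (1 - p)))) t
      = Complex.exp (-((p / (1 - p)) * t ^ 2 / 2 : ℝ)) := by
    rw [charFun_gaussianReal, Real.coe_toNNReal _ hvar0]
    push_cast
    ring_nf
  rw [hgauss]
  refine hlim.congr fun n => ?_
  rw [charFun_apply_real,
    integral_map ((hmeas n).div_const _).aemeasurable (by fun_prop)]
  refine integral_congr_ae (ae_of_all _ fun ω => ?_)
  push_cast
  ring_nf
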